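/- Let λ be a regular uncountable cardinal with 2^{<λ} = λ, and let μ be an uncountable regular cardinal with μ < λ. Then there exists a partial order P of cardinality λ such that: P is separative (whenever p ≰ q there is r ≤ p incompatible with q); P is μ-closed; P is not μ⁺-closed; and P is λ-distributive. -/

import Mathlib

/-- A partial order is `κ`-closed if every `≤`-decreasing sequence of elements indexed by
an ordinal `η < κ` (i.e. `η < κ.ord`) has a lower bound. -/
def IsKappaClosed (P : Type) [Preorder P] (κ : Cardinal) : Prop :=
  ∀ η : Ordinal, η < κ.ord → ∀ p : Ordinal → P,
    (∀ i j : Ordinal, i ≤ j → j < η → p j ≤ p i) →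
    ∃ q : P, ∀ i : Ordinal, i < η → q ≤ p i

/-- Two elements of a partial order are incompatible if they have no common lower bound. -/
def Incompat {P : Type} [Preorder P] (p q : P) : Prop :=
  ¬ ∃ r : P, r ≤ p ∧ r ≤ q

/-- A partial order is separative if whenever `p ≰ q` there is `r ≤ p` incompatible
with `q`. -/
def IsSeparative (P : Type) [Preorder P] : Prop :=
  ∀ p q : P, ¬ p ≤ q → ∃ r : P, r ≤ p ∧ Incompat r q

/-- A subset of a partial order is dense open if every element has an extension in it and
it is downwards closed. -/
def IsDenseOpen {P : Type} [Preorder P] (D : Set P) : Prop :=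
  (∀ p : P, ∃ q ∈ D, q ≤ p) ∧ (∀ p q : P, q ≤ p → p ∈ D → q ∈ D)

/-- A partial order is `λ`-distributive if the intersection of fewer than `λ` dense open
subsets is dense. -/
def IsLambdaDistributive (P : Type) [Preorder P] (lam : Cardinal) : Prop :=
  ∀ (ι : Type) (D : ι → Set P), Cardinal.mk ι < lam → (∀ i, IsDenseOpen (D i)) →
    ∀ p : P, ∃ q : P, q ≤ p ∧ ∀ i, q ∈ D i

/-- A bounded binary sequence on `L`: the length is `top`, the positions carrying a one form `ones`,
and every interval of consecutive ones has fewer than `μ` elements. -/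
@[ext]
structure BlockSeq (L : Type) [LinearOrder L] (μ : Cardinal.{0}) where
  top : L
  ones : Set L
  lt_top : ∀ x ∈ ones, x < top
  small : ∀ x y, Set.Ico x y ⊆ ones → Cardinal.mk (Set.Ico x y) < μ

namespace BlockSeq

open Cardinal Set

variable {L : Type} [LinearOrder L] {μ lam : Cardinal.{0}}

/-- Sequences are ordered by end-extension. -/
instance : PartialOrder (BlockSeq L μ) where
  le p q := q.top ≤ p.top ∧ p.ones ∩ Iio q.top = q.ones
  le_refl p := ⟨le_rfl, inter_eq_left.2 p.lt_top⟩
  le_trans p q r hpq hqr := ⟨hqr.1.trans hpq.1, by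
    rw [← hqr.2, ← hpq.2, inter_assoc, Iio_inter_Iio, min_eq_right hqr.1]⟩
  le_antisymm p q hpq hqp := by
    have h : p.top = q.top := hqp.1.antisymm hpq.1
    refine BlockSeq.ext h ?_
    rw [← hpq.2, ← h]
    exact (inter_eq_left.2 p.lt_top).symm

theorem le_iff {p q : BlockSeq L μ} :
    p ≤ q ↔ q.top ≤ p.top ∧ p.ones ∩ Iio q.top = q.ones := Iff.rfl

theorem mem_iff_of_le {p q : BlockSeq L μ} (h : p ≤ q) {x : L} (hx : x < q.top) :
    x ∈ p.ones ↔ x ∈ q.ones := by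
  rw [← h.2]; simp [hx]

theorem ones_subset_of_le {p q : BlockSeq L μ} (h : p ≤ q) : q.ones ⊆ p.ones := by
  rw [← h.2]; exact inter_subset_left

/-- The sequence of zeros of length `a`. -/
def zeros (hμ : 0 < μ) (a : L) : BlockSeq L μ where
  top := a
  ones := ∅
  lt_top := by simp
  small x y h := by
    rw [subset_empty_iff.1 h]
    simpa using hμ

theorem mk_eq (hμ : 0 < μ) (hlam : ℵ₀ ≤ lam)
    (hL : #L = lam) (hIio : ∀ a : L, #(Iio a) < lam) (hpow : (2 : Cardinal) ^< lam = lam) :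
    #(BlockSeq L μ) = lam := by
  apply le_antisymm
  · let f : BlockSeq L μ → Σ a : L, Set (Iio a) := fun p => ⟨p.top, (↑) ⁻¹' p.ones⟩
    have hf : Function.Injective f := by
      rintro ⟨a, s, hs, _⟩ ⟨b, t, ht, _⟩ h
      obtain rfl : a = b := congrArg Sigma.fst h
      have h' : ((↑) ⁻¹' s : Set (Iio a)) = (↑) ⁻¹' t := eq_of_heq (Sigma.mk.inj h).2
      refine BlockSeq.ext rfl (Set.ext fun x => ⟨fun hx => ?_, fun hx => ?_⟩)
      · exact (Set.ext_iff.1 h' ⟨x, hs x hx⟩).1 hx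
      · exact (Set.ext_iff.1 h' ⟨x, ht x hx⟩).2 hx
    calc #(BlockSeq L μ) ≤ #(Σ a : L, Set (Iio a)) := mk_le_of_injective hf
      _ = Cardinal.sum fun a : L => #(Set (Iio a)) := mk_sigma _
      _ ≤ Cardinal.sum fun _ : L => lam := sum_le_sum _ _ fun a => by
          rw [mk_set]
          exact (le_powerlt 2 (hIio a)).trans_eq hpow
      _ = lam := by rw [sum_const', hL, mul_eq_self hlam]
  · rw [← hL]
    exact mk_le_of_injective (f := zeros hμ) fun a b h => congrArg top h

theorem isSeparative (hμ : ℵ₀ ≤ μ) : IsSeparative (BlockSeq L μ) := by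
  intro p q hpq
  by_cases hc : Incompat p q
  · exact ⟨p, le_rfl, hc⟩
  obtain ⟨r, hrp, hrq⟩ := not_not.1 hc
  have hlt : p.top < q.top := by
    by_contra! h
    refine hpq ⟨h, ?_⟩
    rw [← hrp.2, ← hrq.2, inter_assoc, Iio_inter_Iio, min_eq_right h]
  have hnot : p.top ∉ p.ones := fun h => (p.lt_top _ h).false
  by_cases hq : p.top ∈ q.ones
  · refine ⟨⟨q.top, p.ones, fun x hx => (p.lt_top x hx).trans hlt, p.small⟩,
      ⟨hlt.le, inter_eq_left.2 p.lt_top⟩, ?_⟩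
    rintro ⟨t, h₁, h₂⟩
    exact hnot ((mem_iff_of_le h₁ hlt).1 ((mem_iff_of_le h₂ hlt).2 hq))
  · refine ⟨⟨q.top, insert p.top p.ones, ?_, fun x y h => ?_⟩, ⟨hlt.le, ?_⟩, ?_⟩
    · rintro x (rfl | hx)
      exacts [hlt, (p.lt_top x hx).trans hlt]
    · have hsub : Ico x y ⊆ Ico x (min y p.top) ∪ {p.top} := fun z hz => by
        rcases h hz with rfl | hz'
        · exact Or.inr rfl
        · exact Or.inl ⟨hz.1, lt_min hz.2 (p.lt_top z hz')⟩
      refine ((mk_le_mk_of_subset hsub).trans (mk_union_le _ _)).trans_lt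
        (add_lt_of_lt hμ (p.small _ _ fun z hz => ?_) ?_)
      · have hz' := lt_min_iff.1 hz.2
        exact (h ⟨hz.1, hz'.1⟩).resolve_left hz'.2.ne
      · rw [mk_singleton]
        exact one_lt_aleph0.trans_le hμ
    · ext x
      constructor
      · rintro ⟨rfl | hx, hx'⟩
        exacts [(lt_irrefl _ hx').elim, hx]
      · exact fun hx => ⟨Or.inr hx, p.lt_top x hx⟩
    · rintro ⟨t, h₁, h₂⟩
      exact hq ((mem_iff_of_le h₂ hlt).1 ((mem_iff_of_le h₁ hlt).2 (Or.inl rfl)))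

theorem iUnion_inter_Iio_top {ι : Type} (p : ι → BlockSeq L μ)
    (hp : ∀ i j, p i ≤ p j ∨ p j ≤ p i) (i : ι) :
    (⋃ j, (p j).ones) ∩ Iio (p i).top = (p i).ones := by
  ext x
  simp only [mem_inter_iff, mem_iUnion, mem_Iio]
  constructor
  · rintro ⟨⟨j, hj⟩, hx⟩
    rcases hp i j with h | h
    · exact ones_subset_of_le h hj
    · exact (mem_iff_of_le h hx).1 hj
  · exact fun hx => ⟨⟨i, hx⟩, (p i).lt_top x hx⟩

theorem isKappaClosed (hμ : μ.IsRegular) (hlam : μ ≤ lam)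
    (hbdd : ∀ S : Set L, #S < lam → ∃ a, ∀ x ∈ S, x < a) :
    IsKappaClosed (BlockSeq L μ) μ := by
  intro η hη p hp
  let f : η.ToType → BlockSeq L μ := fun i => p (Ordinal.ToType.toOrd i)
  have hf : ∀ i j, f i ≤ f j ∨ f j ≤ f i := fun i j => by
    rcases le_total (Ordinal.ToType.toOrd i : Ordinal) (Ordinal.ToType.toOrd j) with h | h
    · exact Or.inr (hp _ _ h (Ordinal.ToType.toOrd j).2)
    · exact Or.inl (hp _ _ h (Ordinal.ToType.toOrd i).2)
  have hι : #η.ToType < μ := by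
    rw [mk_toType]
    exact lt_ord.1 hη
  obtain ⟨a, ha⟩ := hbdd (range fun i => (f i).top) (mk_range_le.trans_lt (hι.trans_le hlam))
  rw [forall_mem_range] at ha
  refine ⟨⟨a, ⋃ i, (f i).ones, fun x hx => ?_, fun x y h => ?_⟩, fun i hi => ?_⟩
  · obtain ⟨i, hi⟩ := mem_iUnion.1 hx
    exact ((f i).lt_top x hi).trans (ha i)
  · have hsub : Ico x y ⊆ ⋃ i, Ico x (min y (f i).top) := fun z hz => by
      obtain ⟨i, hi⟩ := mem_iUnion.1 (h hz)
      exact mem_iUnion.2 ⟨i, hz.1, lt_min hz.2 ((f i).lt_top z hi)⟩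
    refine (mk_le_mk_of_subset hsub).trans_lt
      ((card_iUnion_lt_iff_forall_of_isRegular hμ hι).2 fun i => (f i).small _ _ fun z hz => ?_)
    have hz' := lt_min_iff.1 hz.2
    rw [← iUnion_inter_Iio_top f hf i]
    exact ⟨h ⟨hz.1, hz'.1⟩, hz'.2⟩
  · have h : f (Ordinal.ToType.mk ⟨i, hi⟩) = p i := by simp [f]
    rw [← h]
    exact ⟨(ha _).le, iUnion_inter_Iio_top f hf _⟩

/-- `p` properly extends `q` and has a zero right after the end of `q`. -/
def StrongExt (p q : BlockSeq L μ) : Prop :=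
  p ≤ q ∧ q.top < p.top ∧ q.top ∉ p.ones

theorem StrongExt.of_le {p q r : BlockSeq L μ} (h : p ≤ q) (hqr : StrongExt q r) :
    StrongExt p r :=
  ⟨h.trans hqr.1, hqr.2.1.trans_le h.1, fun hr => hqr.2.2 ((mem_iff_of_le h hqr.2.1).1 hr)⟩

theorem exists_strongExt (hbdd : ∀ S : Set L, #S < lam → ∃ a, ∀ x ∈ S, x < a)
    {ι : Type} (hι : #ι < lam) (p : ι → BlockSeq L μ)
    (hp : ∀ i j, p i = p j ∨ StrongExt (p i) (p j) ∨ StrongExt (p j) (p i)) (hμ : 0 < μ) :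
    ∃ q, ∀ i, StrongExt q (p i) := by
  have hle : ∀ i j, p i ≤ p j ∨ p j ≤ p i := fun i j => by
    rcases hp i j with h | h | h
    exacts [Or.inl h.le, Or.inl h.1, Or.inr h.1]
  obtain ⟨a, ha⟩ := hbdd (range fun i => (p i).top) (mk_range_le.trans_lt hι)
  rw [forall_mem_range] at ha
  have hzero : ∀ i, (p i).top ∉ ⋃ j, (p j).ones := fun i hi => by
    obtain ⟨j, hj⟩ := mem_iUnion.1 hi
    rcases hp i j with h | h | h
    · exact ((p j).lt_top _ hj).ne (congrArg top h)
    · exact ((p j).lt_top _ hj).not_gt h.2.1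
    · exact h.2.2 hj
  refine ⟨⟨a, ⋃ i, (p i).ones, fun x hx => ?_, fun x y h => ?_⟩, fun i =>
    ⟨⟨(ha i).le, iUnion_inter_Iio_top p hle i⟩, ha i, hzero i⟩⟩
  · obtain ⟨i, hi⟩ := mem_iUnion.1 hx
    exact ((p i).lt_top x hi).trans (ha i)
  · rcases le_or_gt y x with hxy | hxy
    · rw [Ico_eq_empty hxy.not_gt]
      simpa using hμ
    obtain ⟨i, hi⟩ := mem_iUnion.1 (h ⟨le_rfl, hxy⟩)
    have hy : y ≤ (p i).top := by
      by_contra! hy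
      exact hzero i (h ⟨((p i).lt_top x hi).le, hy⟩)
    refine (p i).small x y fun z hz => ?_
    rw [← iUnion_inter_Iio_top p hle i]
    exact ⟨h hz, hz.2.trans_le hy⟩

theorem isLambdaDistributive (hμ : 0 < μ) (hlam : ℵ₀ ≤ lam)
    (hbdd : ∀ S : Set L, #S < lam → ∃ a, ∀ x ∈ S, x < a) :
    IsLambdaDistributive (BlockSeq L μ) lam := by
  classical
  intro ι D hι hD p
  have hopt : ∀ s : Set ι, #(Option s) < lam := fun s => by
    rw [mk_option]
    exact add_lt_of_lt hlam ((mk_set_le s).trans_lt hι) (one_lt_aleph0.trans_le hlam)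
  let Good (i : ι) (g : ∀ j, WellOrderingRel j i → BlockSeq L μ) (q : BlockSeq L μ) : Prop :=
    q ∈ D i ∧ StrongExt q p ∧ ∀ j hj, StrongExt q (g j hj)
  let F : ι → BlockSeq L μ := WellOrderingRel.isWellOrder.wf.fix fun i g =>
    if h : ∃ q, Good i g q then h.choose else p
  let Spec (i : ι) : Prop := Good i (fun j _ => F j) (F i)
  have hbound : ∀ s : Set ι, (∀ i ∈ s, Spec i) →
      ∃ q, StrongExt q p ∧ ∀ i ∈ s, StrongExt q (F i) := fun s hs => by
    let f : Option s → BlockSeq L μ := fun o => o.elim p fun j => F j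
    obtain ⟨q, hq⟩ := exists_strongExt hbdd (hopt _) f (by
      rintro (_ | j) (_ | k)
      · exact Or.inl rfl
      · exact Or.inr (Or.inr (hs k k.2).2.1)
      · exact Or.inr (Or.inl (hs j j.2).2.1)
      · rcases trichotomous_of WellOrderingRel (j : ι) k with h | h | h
        · exact Or.inr (Or.inr ((hs k k.2).2.2 j h))
        · exact Or.inl (congrArg F h)
        · exact Or.inr (Or.inl ((hs j j.2).2.2 k h))) hμ
    exact ⟨q, hq none, fun i hi => hq (some ⟨i, hi⟩)⟩
  have hF : ∀ i, Spec i := by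
    intro i
    induction i using WellOrderingRel.isWellOrder.wf.induction with
    | _ i ih =>
    obtain ⟨q, hqp, hq⟩ := hbound {j | WellOrderingRel j i} ih
    obtain ⟨r, hrD, hrq⟩ := (hD i).1 q
    have hex : ∃ q, Good i (fun j _ => F j) q :=
      ⟨r, hrD, .of_le hrq hqp, fun j hj => .of_le hrq (hq j hj)⟩
    have hFi : F i = hex.choose := by
      rw [show F i = _ from WellFounded.fix_eq _ _ i]
      exact dif_pos hex
    simp only [Spec]
    rw [hFi]
    exact hex.choose_spec
  obtain ⟨q, hqp, hq⟩ := hbound univ fun i _ => hF i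
  exact ⟨q, hqp.1, fun i => (hD i).2 _ _ (hq i (mem_univ i)).1 (hF i).1⟩

/-- The sequence of ones of length `a`. -/
def allOnes (a : L) (ha : #(Iio a) < μ) : BlockSeq L μ where
  top := a
  ones := Iio a
  lt_top _ hx := hx
  small _ _ h := (mk_le_mk_of_subset h).trans_lt ha

theorem not_isKappaClosed_succ (hμ : ℵ₀ ≤ μ) (hlam : μ < lam) :
    ¬ IsKappaClosed (BlockSeq lam.ord.ToType μ) (Order.succ μ) := by
  intro H
  let e : Iio lam.ord ≃o lam.ord.ToType := Ordinal.ToType.mk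
  have hμl : μ.ord < lam.ord := ord_lt_ord.2 hlam
  have hcard : ∀ i : Iio lam.ord, #(Iio (e i)) = (i : Ordinal).card := fun i =>
    congrArg (fun x : Iio lam.ord => (x : Ordinal).card) (e.symm_apply_apply i)
  have h0 : (0 : Ordinal) < lam.ord := bot_le.trans_lt hμl
  have hbot : ∀ x, e ⟨0, h0⟩ ≤ x := fun x => by
    obtain ⟨i, rfl⟩ := e.surjective x
    exact e.le_iff_le.2 (bot_le : (0 : Ordinal) ≤ i)
  let p : Ordinal → BlockSeq lam.ord.ToType μ := fun i =>
    if h : i < μ.ord then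
      allOnes (e ⟨i, h.trans hμl⟩) (by rw [hcard]; exact lt_ord.1 h)
    else zeros (aleph0_pos.trans_le hμ) (e ⟨0, h0⟩)
  obtain ⟨q, hq⟩ := H μ.ord (ord_lt_ord.2 (Order.lt_succ μ)) p fun i j hij hj => by
    have hi := hij.trans_lt hj
    simp only [p, dif_pos hi, dif_pos hj]
    have h : e ⟨i, hi.trans hμl⟩ ≤ e ⟨j, hj.trans hμl⟩ := e.le_iff_le.2 hij
    exact ⟨h, inter_eq_right.2 (Iio_subset_Iio h)⟩
  have hsub : Ico (e ⟨0, h0⟩) (e ⟨μ.ord, hμl⟩) ⊆ q.ones := fun x hx => by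
    obtain ⟨⟨i, hi⟩, rfl⟩ := e.surjective x
    have hiμ : i < μ.ord := e.lt_iff_lt.1 hx.2
    have hs : Order.succ i < μ.ord := (isSuccLimit_ord hμ).succ_lt hiμ
    refine ones_subset_of_le (hq _ hs) ?_
    simp only [p, dif_pos hs]
    exact e.lt_iff_lt.2 (Order.lt_succ i)
  have h := q.small _ _ hsub
  have hI : Ico (e ⟨0, h0⟩) (e ⟨μ.ord, hμl⟩) = Iio (e ⟨μ.ord, hμl⟩) := 
    Set.ext fun x => ⟨fun hx => hx.2, fun hx => ⟨hbot x, hx⟩⟩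
  rw [hI, hcard, card_ord] at h
  exact h.false

theorem exists_partialOrder (hlam : lam.IsRegular) (hlam' : ℵ₀ < lam)
    (hpow : (2 : Cardinal) ^< lam = lam)
    (hμ : μ.IsRegular) (hμ' : ℵ₀ < μ) (hμlam : μ < lam) :
    ∃ (P : Type) (_ : PartialOrder P), #P = lam ∧ IsSeparative P ∧ IsKappaClosed P μ ∧
      ¬ IsKappaClosed P (Order.succ μ) ∧ IsLambdaDistributive P lam := by
  have hpos : 0 < μ := aleph0_pos.trans hμ'
  have hbdd : ∀ S : Set lam.ord.ToType, #S < lam → ∃ a, ∀ x ∈ S, x < a := fun S hS => by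
    have hS' : ¬ IsCofinal S := fun h => by
      have := Order.cof_le h
      rw [Ordinal.cof_toType, hlam.cof_ord] at this
      exact this.not_gt hS
    simpa [IsCofinal] using hS'
  exact ⟨BlockSeq lam.ord.ToType μ, inferInstance,
    mk_eq hpos hlam'.le (mk_ord_toType lam) (fun a => by simpa using mk_Iio_lt a) hpow,
    isSeparative hμ'.le, isKappaClosed hμ hμlam.le hbdd,
    not_isKappaClosed_succ hμ'.le hμlam,
    isLambdaDistributive hpos hlam'.le hbdd⟩

end BlockSeq


/-- If `λ` is regular uncountable with `2^{<λ} = λ` and `μ < λ` is regular uncountable,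
then there is a separative, `μ`-closed, not `μ⁺`-closed, `λ`-distributive partial order of
cardinality `λ`. -/
theorem exists_mu_closed_not_mu_succ_closed_lambda_distributive
    (lam μ : Cardinal)
    (hlam : lam.IsRegular) (hlam' : Cardinal.aleph0 < lam)
    (hpow : (2 : Cardinal) ^< lam = lam)
    (hμ : μ.IsRegular) (hμ' : Cardinal.aleph0 < μ) (hμlam : μ < lam) :
    ∃ (P : Type) (_ : PartialOrder P),
      Cardinal.mk P = lam ∧
      IsSeparative P ∧
      IsKappaClosed P μ ∧
      ¬ IsKappaClosed P (Order.succ μ) ∧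
      IsLambdaDistributive P lam := by
  exact BlockSeq.exists_partialOrder hlam hlam' hpow hμ hμ' hμlam
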